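/- Least-restrictive hybrid controller guarantee: let n be a natural number, V : ℝⁿ → ℝ be differentiable, v̄ ∈ ℝ, and let ξ : ℝ → ℝⁿ be differentiable with derivative ξ' t at each time t (the closed-loop trajectory under the hybrid controller). Suppose V (ξ 0) ≤ v̄, and that at every time t ≥ 0 at which V (ξ t) ≥ v̄ (i.e. the state is on or beyond the boundary of the tracking error bound, where the safety controller is active), the directional derivative satisfies fderiv ℝ V (ξ t) (ξ' t) ≤ 0. Then V (ξ t) ≤ v̄ for all t ≥ 0; i.e. the trajectory remains in the tracking error bound {x | V x ≤ v̄} for all time. -/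

import Mathlib

/-- A differentiable function that starts below `c` and has nonpositive derivative wherever it is
at least `c` stays below `c`: compare it with the lines `x ↦ c + ε * x`. -/
theorem le_of_hasDerivAt_nonpos_of_le {f f' : ℝ → ℝ} {c : ℝ}
    (hf : ∀ t, HasDerivAt f (f' t) t) (h0 : f 0 ≤ c)
    (hf' : ∀ t, 0 ≤ t → c ≤ f t → f' t ≤ 0) {t : ℝ} (ht : 0 ≤ t) : f t ≤ c := by
  have key : ∀ ε > 0, f t ≤ c + ε * t := fun ε hε =>
    image_le_of_deriv_right_lt_deriv_boundary (f' := f') (B := fun x => c + ε * x)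
      (B' := fun _ => ε) (fun x _ => (hf x).continuousAt.continuousWithinAt)
      (fun x _ => (hf x).hasDerivWithinAt) (by simpa using h0)
      (fun x => by simpa using ((hasDerivAt_id x).const_mul ε).const_add c)
      (fun x hx hfx => (hf' x hx.1 (by
        rw [hfx]
        exact le_add_of_nonneg_right (mul_nonneg hε.le hx.1))).trans_lt hε)
      ⟨ht, le_rfl⟩
  refine le_of_forall_pos_le_add fun δ hδ => (key (δ / (t + 1)) (by positivity)).trans ?_
  gcongr
  rw [div_mul_eq_mul_div, div_le_iff₀ (by positivity)]
  nlinarith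

/-- FaSTrack least-restrictive hybrid controller guarantee: let `V : ℝⁿ → ℝ` be
differentiable, `ξ` a differentiable trajectory with derivative `ξ' t` at each
time, `V (ξ 0) ≤ vBar`, and suppose at every time `t ≥ 0` with `V (ξ t) ≥ vBar`
(safety controller active) the directional derivative satisfies
`fderiv ℝ V (ξ t) (ξ' t) ≤ 0`. Then `V (ξ t) ≤ vBar` for all `t ≥ 0`: the
trajectory remains in the tracking error bound `{x | V x ≤ vBar}`. -/
theorem fastrack_hybrid_controller_guarantee
    (n : ℕ) (V : (Fin n → ℝ) → ℝ) (vBar : ℝ)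
    (hV : Differentiable ℝ V)
    (ξ : ℝ → (Fin n → ℝ)) (ξ' : ℝ → (Fin n → ℝ))
    (hξ : ∀ t : ℝ, HasDerivAt ξ (ξ' t) t)
    (h0 : V (ξ 0) ≤ vBar)
    (hsafe : ∀ t : ℝ, 0 ≤ t → vBar ≤ V (ξ t) → fderiv ℝ V (ξ t) (ξ' t) ≤ 0) :
    ∀ t : ℝ, 0 ≤ t → V (ξ t) ≤ vBar := by
  intro t ht
  exact le_of_hasDerivAt_nonpos_of_le (f := fun s => V (ξ s))
    (fun s => (hV (ξ s)).hasFDerivAt.comp_hasDerivAt s (hξ s)) h0 hsafe ht
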